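/- There exists a constant c > 0 such that for all integers N ≥ 1, j ≥ 1, and all (j+1)-tuples (s_0, s_1, …, s_j) of nonnegative integers with s_0 + s_1 + … + s_j = 2N, setting t_r = s_0 + … + s_r: the number of paths ω : {0,1,…,2N} → ℤ² with ω(0) = ω(2N) = (0,0), each increment ω(m+1) − ω(m) ∈ {(1,0), (−1,0), (0,1), (0,−1)}, and second coordinate of ω equal to 0 at each of the times t_0, t_1, …, t_{j−1}, is at most C(2N,N)² · (2N+1)^{1/2} · c^{j+1} · ∏_{r=0}^{j} (s_r + 1)^{−1/2}. -/

import Mathlib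

/-- The four unit steps of the simple symmetric random walk on `ℤ²`. -/
def step : Fin 4 → ℤ × ℤ := ![(1, 0), (-1, 0), (0, 1), (0, -1)]

/-- The position at time `t` of the path on `ℤ²` started at the origin with step
sequence `ε` (partial sum of the first `t` steps). -/
def pos {n : ℕ} (ε : Fin n → Fin 4) (t : ℕ) : ℤ × ℤ :=
  ∑ i : Fin n, if (i : ℕ) < t then step (ε i) else 0

open Finset

/-- Restricting a function to the fibres of `f` turns a sum of products into a product of sums. -/
theorem sum_prod_fiber {ι κ α : Type*} [Fintype ι] [DecidableEq ι] [Fintype κ] [DecidableEq κ]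
    [Fintype α] (f : ι → κ) (G : ∀ k, ({i // f i = k} → α) → ℝ) :
    ∑ m : ι → α, ∏ k, G k (fun i => m i) = ∏ k, ∑ m : {i // f i = k} → α, G k m := by
  let e : (ι → α) ≃ (∀ k, {i // f i = k} → α) :=
    { toFun := fun m k i => m i
      invFun := fun p i => p (f i) ⟨i, rfl⟩
      left_inv := fun m => rfl
      right_inv := fun p => by
        ext k ⟨i, h⟩
        subst h
        rfl }
  rw [Finset.prod_univ_sum, Fintype.piFinset_univ]
  exact Fintype.sum_equiv e _ _ fun m => rfl

theorem two_mul_add_one_mul_centralBinom_sq_le (n : ℕ) :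
    (2 * n + 1) * n.centralBinom ^ 2 ≤ 16 ^ n := by
  induction n with
  | zero => simp
  | succ n ih =>
    have h := Nat.succ_mul_centralBinom_succ n
    have hp : 0 < (n + 1) ^ 2 := by positivity
    refine Nat.le_of_mul_le_mul_left ?_ hp
    calc (n + 1) ^ 2 * ((2 * (n + 1) + 1) * (n + 1).centralBinom ^ 2)
        = (2 * n + 3) * ((n + 1) * (n + 1).centralBinom) ^ 2 := by ring
      _ = (4 * (2 * n + 3) * (2 * n + 1)) * ((2 * n + 1) * n.centralBinom ^ 2) := by rw [h]; ring
      _ ≤ (16 * (n + 1) ^ 2) * 16 ^ n := Nat.mul_le_mul (by nlinarith) ih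
      _ = (n + 1) ^ 2 * 16 ^ (n + 1) := by ring

theorem sixteen_pow_le_mul_centralBinom_sq {n : ℕ} (hn : 1 ≤ n) :
    16 ^ n ≤ 4 * n * n.centralBinom ^ 2 := by
  induction n, hn using Nat.le_induction with
  | base => simp [Nat.centralBinom, Nat.choose]
  | succ n hn ih =>
    have h := Nat.succ_mul_centralBinom_succ n
    have hp : 0 < n + 1 := by positivity
    refine Nat.le_of_mul_le_mul_left ?_ hp
    calc (n + 1) * 16 ^ (n + 1) = (16 * (n + 1)) * 16 ^ n := by ring
      _ ≤ (16 * (n + 1)) * (4 * n * n.centralBinom ^ 2) := Nat.mul_le_mul_left _ ih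
      _ = (16 * (4 * n * (n + 1))) * n.centralBinom ^ 2 := by ring
      _ ≤ (16 * (2 * n + 1) ^ 2) * n.centralBinom ^ 2 := Nat.mul_le_mul_right _ (by nlinarith)
      _ = 4 * ((n + 1) * (n + 1).centralBinom) ^ 2 := by rw [h]; ring
      _ = (n + 1) * (4 * (n + 1) * (n + 1).centralBinom ^ 2) := by ring

/-- The sign `±1` encoded by a Boolean. -/
def boolSign (b : Bool) : ℤ := if b then 1 else -1

theorem card_sum_boolSign_eq_zero_le (ι : Type*) [Fintype ι] [DecidableEq ι] :
    (#{σ : ι → Bool | ∑ i, boolSign (σ i) = 0} : ℝ)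
      ≤ 2 ^ Fintype.card ι / √(Fintype.card ι + 1) := by
  have key : ∀ σ : ι → Bool, ∑ i, boolSign (σ i) = 2 * #{i | σ i} - Fintype.card ι := by
    intro σ
    have h : ∀ i, boolSign (σ i) = 2 * (if σ i then 1 else 0) - 1 := by
      intro i
      cases σ i <;> simp [boolSign]
    simp only [h, Finset.sum_sub_distrib, ← Finset.mul_sum, Finset.sum_boole]
    simp
  obtain ⟨m, hm⟩ | hodd := Nat.even_or_odd (Fintype.card ι)
  · have h1 : #{σ : ι → Bool | ∑ i, boolSign (σ i) = 0} ≤ m.centralBinom := by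
      have : #(powersetCard m (univ : Finset ι)) = m.centralBinom := by
        rw [card_powersetCard, card_univ, hm, Nat.centralBinom, two_mul]
      rw [← this]
      refine card_le_card_of_injOn (fun σ => ({i | σ i} : Finset ι)) ?_ ?_
      · intro σ hσ
        simp only [mem_coe, mem_filter, mem_univ, true_and, key, hm] at hσ
        rw [mem_coe, mem_powersetCard_univ]
        change #{i | σ i = true} = m
        push_cast at hσ
        omega
      · intro σ _ τ _ h
        ext1 i
        have := Finset.ext_iff.1 h i
        rw [mem_filter_univ, mem_filter_univ] at this
        exact Bool.eq_iff_iff.2 this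
    rw [le_div_iff₀ (by positivity)]
    refine le_trans (mul_le_mul_of_nonneg_right (Nat.cast_le.2 h1) (by positivity)) ?_
    refine abs_le_of_sq_le_sq' ?_ (by positivity) |>.2
    rw [mul_pow, Real.sq_sqrt (by positivity), hm]
    have := two_mul_add_one_mul_centralBinom_sq_le m
    have h2 : ((2 * m + 1) * m.centralBinom ^ 2 : ℝ) ≤ 16 ^ m := by exact_mod_cast this
    calc _ = ((2 * m + 1) * m.centralBinom ^ 2 : ℝ) := by push_cast; ring
      _ ≤ 16 ^ m := h2
      _ = _ := by rw [← pow_mul, show (16 : ℝ) = 2 ^ 4 by norm_num, ← pow_mul]; congr 1; ring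
  · have : #{σ : ι → Bool | ∑ i, boolSign (σ i) = 0} = 0 := by
      rw [card_eq_zero, filter_eq_empty_iff]
      intro σ _ h
      rw [key] at h
      obtain ⟨k, hk⟩ := hodd
      omega
    rw [this, Nat.cast_zero]
    positivity

theorem sum_bool_fun_eq_sum_range_choose (ι : Type*) [Fintype ι] [DecidableEq ι] (g : ℕ → ℝ) :
    ∑ m : ι → Bool, g #{i | m i = true}
      = ∑ k ∈ range (Fintype.card ι + 1), (Fintype.card ι).choose k * g k := by
  have h := Finset.sum_powerset_apply_card g (x := (univ : Finset ι))
  rw [powerset_univ, card_univ] at h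
  simp only [nsmul_eq_mul] at h
  rw [← h]
  refine Finset.sum_nbij' (fun m => ({i | m i = true} : Finset ι)) (fun s i => decide (i ∈ s))
    ?_ ?_ ?_ ?_ ?_ <;> simp

theorem inv_sqrt_le_half_add {a b : ℝ} (ha : 0 < a) (hb : 0 < b) :
    1 / √a ≤ (1 / √b + √b / a) / 2 := by
  have ha' := Real.sqrt_pos.2 ha
  have hb' := Real.sqrt_pos.2 hb
  have : √b / a = √b / (√a * √a) := by rw [Real.mul_self_sqrt ha.le]
  rw [this, ← sub_nonneg]
  have : (1 / √b + √b / (√a * √a)) / 2 - 1 / √a = (√a - √b) ^ 2 / (2 * √a ^ 2 * √b) := by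
    field_simp
    ring
  rw [this]
  positivity

theorem sum_choose_mul_pow_div_succ_le (n : ℕ) {x : ℝ} (hx : 0 ≤ x) :
    ∑ k ∈ range (n + 1), n.choose k * (x ^ (n - k) / (k + 1)) ≤ (1 + x) ^ (n + 1) / (n + 1) := by
  rw [le_div_iff₀ (by positivity), add_pow, Finset.sum_range_succ' _ (n + 1), Finset.sum_mul]
  refine le_add_of_le_of_nonneg (Finset.sum_le_sum fun k hk => le_of_eq ?_) (by positivity)
  have h : ((n + 1 : ℕ) * n.choose k : ℝ) = (n + 1).choose (k + 1) * (k + 1 : ℕ) := by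
    exact_mod_cast Nat.add_one_mul_choose_eq n k
  rw [Nat.add_sub_add_right, one_pow, one_mul]
  push_cast at h
  field_simp
  linear_combination x ^ (n - k) * h

theorem sum_pow_div_sqrt_le (ι : Type*) [Fintype ι] [DecidableEq ι] {x : ℝ} (hx : 0 ≤ x)
    (hx1 : x ≤ 1) :
    ∑ m : ι → Bool, x ^ #{i | m i = false} / √(#{i | m i = true} + 1)
      ≤ 3 / 2 * (1 + x) ^ Fintype.card ι / √(Fintype.card ι + 1) := by
  have hc : ∀ m : ι → Bool, #{i | m i = false} = Fintype.card ι - #{i | m i = true} := by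
    intro m
    rw [← card_univ, ← card_filter_add_card_filter_not (s := univ) (fun i => m i = true)]
    simp
  simp only [hc]
  rw [sum_bool_fun_eq_sum_range_choose ι
    (fun k => x ^ (Fintype.card ι - k) / √((k : ℝ) + 1))]
  set n := Fintype.card ι
  have hn : (0 : ℝ) < n + 1 := by positivity
  have hb : ∑ k ∈ range (n + 1), (n.choose k : ℝ) * x ^ (n - k) = (1 + x) ^ n := by
    rw [add_pow]
    exact Finset.sum_congr rfl fun k _ => by ring
  have hs := Real.sq_sqrt hn.le
  have hs0 := Real.sqrt_pos.2 hn
  calc ∑ k ∈ range (n + 1), (n.choose k : ℝ) * (x ^ (n - k) / √((k : ℝ) + 1))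
      ≤ ∑ k ∈ range (n + 1), (1 / √((n : ℝ) + 1) / 2 * (n.choose k * x ^ (n - k)) +
          √((n : ℝ) + 1) / 2 * (n.choose k * (x ^ (n - k) / (k + 1)))) := by
        refine Finset.sum_le_sum fun k _ => ?_
        have h := inv_sqrt_le_half_add (a := (k : ℝ) + 1) (by positivity) hn
        have h' := mul_le_mul_of_nonneg_left h
          (show (0 : ℝ) ≤ n.choose k * x ^ (n - k) by positivity)
        refine le_trans (le_of_eq ?_) (h'.trans (le_of_eq ?_)) <;> ring
    _ ≤ 1 / √((n : ℝ) + 1) / 2 * (1 + x) ^ n +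
          √((n : ℝ) + 1) / 2 * ((1 + x) ^ (n + 1) / (n + 1)) := by
        rw [Finset.sum_add_distrib, ← Finset.mul_sum, ← Finset.mul_sum, hb]
        gcongr
        exact sum_choose_mul_pow_div_succ_le n hx
    _ = (2 + x) / 2 * (1 + x) ^ n / √((n : ℝ) + 1) := by
        have : √((n : ℝ) + 1) / (n + 1) = 1 / √((n : ℝ) + 1) := by
          rw [div_eq_div_iff hn.ne' hs0.ne']
          linear_combination hs
        linear_combination ((1 + x) ^ (n + 1) / 2) * this
    _ ≤ _ := by gcongr; linarith

/-- The class of a step: its block if it is vertical, `none` if it is horizontal. -/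
def stepClass {ι κ : Type*} (f : ι → κ) (m : ι → Bool) (i : ι) : Option κ :=
  if m i then some (f i) else none

theorem card_sum_boolSign_fiber_eq_zero_le {ι κ : Type*} [Fintype ι] [DecidableEq ι] [Fintype κ]
    [DecidableEq κ] (g : ι → κ) :
    (#{σ : ι → Bool | ∀ k, ∑ i with g i = k, boolSign (σ i) = 0} : ℝ)
      ≤ 2 ^ Fintype.card ι * ∏ k, 1 / √(#{i | g i = k} + 1) := by
  have h1 : (#{σ : ι → Bool | ∀ k, ∑ i with g i = k, boolSign (σ i) = 0} : ℝ)
      = ∑ σ : ι → Bool, ∏ k,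
        (fun τ : {i // g i = k} → Bool => if ∑ i, boolSign (τ i) = 0 then (1 : ℝ) else 0)
          (fun i => σ i) := by
    rw [card_filter, Nat.cast_sum]
    refine Finset.sum_congr rfl fun σ _ => ?_
    have : ∀ k, ∑ i : {i // g i = k}, boolSign (σ i) = ∑ i with g i = k, boolSign (σ i) :=
      fun k => (Finset.sum_subtype _ (fun i => by rw [mem_filter_univ]) fun i => boolSign (σ i)).symm
    simp only [this, Finset.prod_boole]
    simp
  have h2 : ∑ k, #{i | g i = k} = Fintype.card ι := by
    rw [← card_univ, ← Finset.card_eq_sum_card_fiberwise (fun i _ => mem_univ (g i))]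
  rw [h1, sum_prod_fiber g
    (fun k τ => if ∑ i, boolSign (τ i) = 0 then (1 : ℝ) else 0), ← h2,
    ← Finset.prod_pow_eq_pow_sum, ← Finset.prod_mul_distrib]
  refine Finset.prod_le_prod (fun k _ => by positivity) fun k _ => ?_
  have h := card_sum_boolSign_eq_zero_le {i // g i = k}
  rw [Fintype.card_subtype] at h
  rw [Finset.sum_boole, mul_one_div]
  exact h

theorem sum_prod_stepClass_le {ι κ : Type*} [Fintype ι] [DecidableEq ι] [Fintype κ]
    [DecidableEq κ] (f : ι → κ) {N : ℕ} (hN : Fintype.card ι = 2 * N) :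
    ∑ m : ι → Bool, ∏ k, 1 / √((#{i | stepClass f m i = k} : ℝ) + 1)
      ≤ 6 * 4 ^ N / √((N : ℝ) + 1) *
        ∏ r, (3 / 2 * (1 / √((#{i | f i = r} : ℝ) + 1))) := by
  have hsome : ∀ (m : ι → Bool) (r : κ),
      #{i | stepClass f m i = some r} = #{i : {i // f i = r} | m i = true} := by
    intro m r
    rw [← card_map (Function.Embedding.subtype _)]
    congr 1
    ext i
    simp [stepClass, and_comm]
  have hnone : ∀ m : ι → Bool,
      #{i | stepClass f m i = none} = ∑ r, #{i : {i // f i = r} | m i = false} := by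
    intro m
    rw [Finset.card_eq_sum_card_fiberwise (f := f) (t := univ) (fun i _ => mem_univ (f i))]
    refine Finset.sum_congr rfl fun r _ => ?_
    rw [← card_map (Function.Embedding.subtype _)]
    congr 1
    ext i
    simp [stepClass, and_comm]
  have hcard : ∑ r, #{i | f i = r} = 2 * N := by
    rw [← hN, ← card_univ, ← Finset.card_eq_sum_card_fiberwise (fun i _ => mem_univ (f i))]
  have hN0 : (0 : ℝ) < N + 1 := by positivity
  have hsN := Real.sqrt_pos.2 hN0
  have hH : ∀ H : ℕ, 1 / √((H : ℝ) + 1) ≤ 2 / √((N : ℝ) + 1) + 2 ^ N * (1 / 4) ^ H := by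
    intro H
    by_cases h : N ≤ 2 * H
    · have : 1 / √((H : ℝ) + 1) ≤ 2 / √((N : ℝ) + 1) := by
        rw [div_le_div_iff₀ (by positivity) hsN, one_mul]
        refine Real.sqrt_le_iff.2 ⟨by positivity, ?_⟩
        rw [mul_pow, Real.sq_sqrt (by positivity)]
        have : (N : ℝ) ≤ 2 * H := by exact_mod_cast h
        linarith
      exact this.trans (le_add_of_nonneg_right (by positivity))
    · have h1 : 1 / √((H : ℝ) + 1) ≤ 1 := by
        rw [div_le_one (by positivity), Real.one_le_sqrt]
        linarith [(Nat.cast_nonneg H : (0 : ℝ) ≤ H)]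
      have h2 : (1 : ℝ) ≤ 2 ^ N * (1 / 4) ^ H := by
        rw [one_div, inv_pow, ← div_eq_mul_inv, one_le_div (by positivity),
          show (4 : ℝ) = 2 ^ 2 by norm_num, ← pow_mul]
        exact pow_le_pow_right₀ one_le_two (by omega)
      have : 0 ≤ 2 / √((N : ℝ) + 1) := by positivity
      linarith
  have hx : ∀ x : ℝ, 0 ≤ x → x ≤ 1 →
      ∑ m : ι → Bool, x ^ #{i | stepClass f m i = none} *
        ∏ r, 1 / √((#{i | stepClass f m i = some r} : ℝ) + 1)
      ≤ ((1 + x) ^ 2) ^ N * ∏ r, (3 / 2 * (1 / √((#{i | f i = r} : ℝ) + 1))) := by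
    intro x hx0 hx1
    simp only [hsome, hnone, ← Finset.prod_pow_eq_pow_sum, ← Finset.prod_mul_distrib]
    rw [sum_prod_fiber f (fun r τ => x ^ #{i | τ i = false} * (1 / √((#{i | τ i = true} : ℝ) + 1))),
      ← pow_mul, ← hcard, ← Finset.prod_pow_eq_pow_sum, ← Finset.prod_mul_distrib]
    refine Finset.prod_le_prod (fun k _ => by positivity) fun r _ => ?_
    have h := sum_pow_div_sqrt_le {i // f i = r} hx0 hx1
    rw [Fintype.card_subtype] at h
    simp only [mul_one_div]
    refine h.trans (le_of_eq (by ring))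
  have hA := hx 1 zero_le_one le_rfl
  have hB := hx (1 / 4) (by norm_num) (by norm_num)
  have hP0 : 0 ≤ ∏ r, (3 / 2 * (1 / √((#{i | f i = r} : ℝ) + 1))) :=
    Finset.prod_nonneg fun r _ => by positivity
  clear hx
  generalize ∏ r, (3 / 2 * (1 / √((#{i | f i = r} : ℝ) + 1))) = P at hA hB hP0 ⊢
  have hdecay : 2 ^ N * ((1 + 1 / 4 : ℝ) ^ 2) ^ N ≤ 4 * 4 ^ N / √((N : ℝ) + 1) := by
    have h1 : (1 : ℝ) + N * (7 / 25) ≤ (1 + 7 / 25) ^ N :=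
      one_add_mul_le_pow (by norm_num) N
    have h2 : √((N : ℝ) + 1) ≤ N + 1 := by
      refine Real.sqrt_le_iff.2 ⟨hN0.le, ?_⟩
      nlinarith [(Nat.cast_nonneg N : (0 : ℝ) ≤ N)]
    have h3 : √((N : ℝ) + 1) ≤ 4 * (1 + 7 / 25) ^ N := by
      linarith [(Nat.cast_nonneg N : (0 : ℝ) ≤ N)]
    rw [le_div_iff₀ hsN]
    calc _ ≤ 2 ^ N * ((1 + 1 / 4 : ℝ) ^ 2) ^ N * (4 * (1 + 7 / 25) ^ N) := by gcongr
      _ = 4 * (2 * (1 + 1 / 4) ^ 2 * (1 + 7 / 25)) ^ N := by rw [mul_pow, mul_pow]; ring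
      _ = 4 * 4 ^ N := by norm_num
  calc ∑ m : ι → Bool, ∏ k, 1 / √((#{i | stepClass f m i = k} : ℝ) + 1)
      ≤ ∑ m : ι → Bool, (2 / √((N : ℝ) + 1) * (1 ^ #{i | stepClass f m i = none} *
          ∏ r, 1 / √((#{i | stepClass f m i = some r} : ℝ) + 1)) +
          2 ^ N * ((1 / 4) ^ #{i | stepClass f m i = none} *
          ∏ r, 1 / √((#{i | stepClass f m i = some r} : ℝ) + 1))) := by
        refine Finset.sum_le_sum fun m _ => ?_
        rw [Fintype.prod_option]
        have h := mul_le_mul_of_nonneg_right (hH #{i | stepClass f m i = none})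
          (show 0 ≤ ∏ r, 1 / √((#{i | stepClass f m i = some r} : ℝ) + 1) by positivity)
        refine h.trans (le_of_eq ?_)
        rw [one_pow]
        ring
    _ ≤ 2 / √((N : ℝ) + 1) * (((1 + 1) ^ 2) ^ N * P)
          + 2 ^ N * (((1 + 1 / 4) ^ 2) ^ N * P) := by
        rw [Finset.sum_add_distrib, ← Finset.mul_sum, ← Finset.mul_sum]
        gcongr
    _ ≤ 2 / √((N : ℝ) + 1) * (((1 + 1) ^ 2) ^ N * P) + 4 * 4 ^ N / √((N : ℝ) + 1) * P := by
        rw [← mul_assoc (2 ^ N)]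
        gcongr
    _ = _ := by
        rw [show ((1 + 1 : ℝ) ^ 2) = 4 by norm_num]
        ring

theorem card_paths_fiber_le {ι κ : Type*} [Fintype ι] [DecidableEq ι] [Fintype κ]
    [DecidableEq κ] (f : ι → κ) {N : ℕ} (hN : Fintype.card ι = 2 * N) :
    (#{ε : ι → Fin 4 | ∑ i, (step (ε i)).1 = 0 ∧
        ∀ r, ∑ i with f i = r, (step (ε i)).2 = 0} : ℝ)
      ≤ 16 ^ N * 6 / √((N : ℝ) + 1) * ∏ r, (3 / 2 * (1 / √((#{i | f i = r} : ℝ) + 1))) := by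
  let vert : Fin 4 → Bool := ![false, false, true, true]
  let sign : Fin 4 → Bool := ![true, false, true, false]
  have hinj : ∀ a b, vert a = vert b → sign a = sign b → a = b := by decide
  have hfst : ∀ a, (step a).1 = if vert a then 0 else boolSign (sign a) := by decide
  have hsnd : ∀ a, (step a).2 = if vert a then boolSign (sign a) else 0 := by decide
  have h1 : #{ε : ι → Fin 4 | ∑ i, (step (ε i)).1 = 0 ∧
        ∀ r, ∑ i with f i = r, (step (ε i)).2 = 0}
      ≤ #((univ : Finset (ι → Bool)).sigma fun m =>
        {σ : ι → Bool | ∀ k, ∑ i with stepClass f m i = k, boolSign (σ i) = 0}) := by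
    refine card_le_card_of_injOn (fun ε => ⟨fun i => vert (ε i), fun i => sign (ε i)⟩) ?_ ?_
    · intro ε hε
      simp only [mem_coe, mem_filter, mem_univ, true_and] at hε
      simp only [coe_sigma, Set.mem_sigma_iff, mem_coe, mem_univ, mem_filter, true_and]
      intro k
      cases k with
      | none =>
        rw [← hε.1, Finset.sum_filter]
        refine Finset.sum_congr rfl fun i _ => ?_
        rw [hfst]
        cases h : vert (ε i) <;> simp [stepClass, h]
      | some r =>
        rw [← hε.2 r, Finset.sum_filter, Finset.sum_filter]
        refine Finset.sum_congr rfl fun i _ => ?_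
        rw [hsnd]
        cases h : vert (ε i) <;> simp [stepClass, h]
    · intro ε _ δ _ h
      simp only [Sigma.mk.injEq, heq_eq_eq] at h
      ext1 i
      exact hinj _ _ (congrFun h.1 i) (congrFun h.2 i)
  calc _ ≤ ((#((univ : Finset (ι → Bool)).sigma fun m =>
        {σ : ι → Bool | ∀ k, ∑ i with stepClass f m i = k, boolSign (σ i) = 0}) : ℕ) : ℝ) :=
        Nat.cast_le.2 h1
    _ ≤ ∑ m : ι → Bool, 2 ^ Fintype.card ι * ∏ k, 1 / √((#{i | stepClass f m i = k} : ℝ) + 1) := by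
        rw [card_sigma, Nat.cast_sum]
        exact Finset.sum_le_sum fun m _ => card_sum_boolSign_fiber_eq_zero_le (stepClass f m)
    _ ≤ 2 ^ Fintype.card ι * (6 * 4 ^ N / √((N : ℝ) + 1) *
        ∏ r, (3 / 2 * (1 / √((#{i | f i = r} : ℝ) + 1)))) := by
        rw [← Finset.mul_sum]
        gcongr
        exact sum_prod_stepClass_le f hN
    _ = _ := by
        rw [hN, pow_mul, show (16 : ℝ) = 2 ^ 2 * 4 by norm_num, mul_pow]
        ring

/-- Consecutive intervals of lengths `s r` partition `Fin n` when the lengths add up to `n`. -/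
theorem exists_block_map {n j : ℕ} (s : Fin (j + 1) → ℕ) (hs : ∑ r, s r = n) :
    ∃ f : Fin n → Fin (j + 1), (∀ r, #{i | f i = r} = s r) ∧
      ∀ (r : Fin (j + 1)) (i : Fin n), f i = r ↔
        (∑ q : Fin (j + 1), if (q : ℕ) < r then s q else 0) ≤ i ∧
        (i : ℕ) < ∑ q : Fin (j + 1), if (q : ℕ) < r + 1 then s q else 0 := by
  let T : ℕ → ℕ := fun k => ∑ q : Fin (j + 1), if (q : ℕ) < k then s q else 0
  have hmono : Monotone T := by
    intro a b hab
    refine Finset.sum_le_sum fun q _ => ?_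
    split_ifs <;> omega
  have hT0 : T 0 = 0 := by simp [T]
  have hTlast : T (j + 1) = n := by simp only [T, Fin.is_lt, if_true, hs]
  have hTsucc : ∀ r : Fin (j + 1), T (r + 1) = T r + s r := by
    intro r
    have : s r = ∑ q : Fin (j + 1), if q = r then s q else 0 := by simp
    rw [this, ← Finset.sum_add_distrib]
    refine Finset.sum_congr rfl fun q _ => ?_
    simp only [Fin.ext_iff]
    split_ifs <;> omega
  have hex : ∀ i : Fin n, ∃ r : Fin (j + 1), T r ≤ i ∧ (i : ℕ) < T (r + 1) := by
    intro i
    have hi : ∃ k, (i : ℕ) < T (k + 1) := ⟨j, by rw [hTlast]; exact i.2⟩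
    classical
    have hle : Nat.find hi ≤ j := Nat.find_min' hi (by rw [hTlast]; exact i.2)
    refine ⟨⟨Nat.find hi, by omega⟩, ?_, Nat.find_spec hi⟩
    rcases Nat.eq_zero_or_pos (Nat.find hi) with h | h
    · simp [h, hT0]
    · have := Nat.find_min hi (m := Nat.find hi - 1) (by omega)
      rw [Nat.sub_add_cancel h] at this
      simpa using this
  choose f hf using hex
  have hiff : ∀ (r : Fin (j + 1)) (i : Fin n), f i = r ↔ T r ≤ i ∧ (i : ℕ) < T (r + 1) := by
    refine fun r i => ⟨fun h => h ▸ hf i, fun h => ?_⟩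
    obtain ⟨h1, h2⟩ := hf i
    rcases lt_trichotomy (f i) r with hlt | heq | hlt
    · have := hmono (show (f i : ℕ) + 1 ≤ r from hlt)
      omega
    · exact heq
    · have := hmono (show (r : ℕ) + 1 ≤ f i from hlt)
      omega
  refine ⟨f, fun r => ?_, hiff⟩
  have hle : T (r + 1) ≤ n := hTlast ▸ hmono (by omega)
  rw [← card_map Fin.valEmbedding]
  have : ({i | f i = r} : Finset (Fin n)).map Fin.valEmbedding = Finset.Ico (T r) (T (r + 1)) := by
    ext k
    simp only [mem_map, mem_filter, mem_univ, true_and, hiff, Fin.valEmbedding_apply, mem_Ico]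
    exact ⟨fun ⟨i, h, e⟩ => e ▸ h, fun h => ⟨⟨k, by omega⟩, h, rfl⟩⟩
  rw [this, Nat.card_Ico, hTsucc]
  omega

theorem pos_sub_pos_snd {n : ℕ} (ε : Fin n → Fin 4) {a b : ℕ} (hab : a ≤ b) :
    (pos ε b).2 - (pos ε a).2
      = ∑ i ∈ ({i | a ≤ (i : ℕ) ∧ (i : ℕ) < b} : Finset (Fin n)), (step (ε i)).2 := by
  simp only [pos, Prod.snd_sum, Finset.sum_filter, ← Finset.sum_sub_distrib]
  refine Finset.sum_congr rfl fun i _ => ?_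
  rcases lt_or_ge (i : ℕ) a with h1 | h1 <;> rcases lt_or_ge (i : ℕ) b with h2 | h2
  · simp [h1, h2]
  · omega
  · simp [h1, h2, h1.not_gt]
  · simp [h1.not_gt, h2.not_gt]

/-- There is a constant `c > 0` such that for all `N, j ≥ 1` and all `(j+1)`-tuples
`(s_0,…,s_j)` of nonnegative integers summing to `2N`, the number of paths of length
`2N` on `ℤ²` from the origin to the origin (with unit steps) whose second coordinate
vanishes at each of the times `t_r = s_0 + … + s_r`, `r = 0,…,j−1`, is at most
`C(2N,N)²·(2N+1)^{1/2}·c^{j+1}·∏_{r=0}^{j}(s_r+1)^{−1/2}`. -/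
theorem conditioned_walk_pinning_upper_bound :
    ∃ c : ℝ, 0 < c ∧ ∀ N j : ℕ, 1 ≤ N → 1 ≤ j → ∀ s : Fin (j+1) → ℕ,
      (∑ r, s r) = 2*N →
      ((Finset.univ.filter (fun ε : Fin (2*N) → Fin 4 =>
          pos ε (2*N) = 0 ∧
          ∀ r : Fin j,
            (pos ε (∑ i : Fin (j+1), if (i : ℕ) ≤ (r : ℕ) then s i else 0)).2 = 0)).card : ℝ)
        ≤ (((2*N).choose N : ℝ))^2 * Real.sqrt (2*(N : ℝ) + 1) * c ^ (j+1)
            * ∏ r : Fin (j+1), ((s r : ℝ) + 1) ^ (-(1:ℝ)/2) := by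
  refine ⟨36, by norm_num, fun N j hN _ s hs => ?_⟩
  obtain ⟨f, hcard, hf⟩ := exists_block_map s hs
  have hmain : (#{ε : Fin (2 * N) → Fin 4 | ∑ i, (step (ε i)).1 = 0 ∧
        ∀ r, ∑ i with f i = r, (step (ε i)).2 = 0} : ℝ)
      ≤ 16 ^ N * 6 / √((N : ℝ) + 1) * ∏ r, (3 / 2 * (1 / √((s r : ℝ) + 1))) := by
    simp only [← hcard]
    convert card_paths_fiber_le f (Fintype.card_fin (2 * N))
  have hsub : ∀ ε : Fin (2 * N) → Fin 4, (pos ε (2 * N) = 0 ∧ ∀ r : Fin j,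
        (pos ε (∑ i : Fin (j + 1), if (i : ℕ) ≤ (r : ℕ) then s i else 0)).2 = 0) →
      ∑ i, (step (ε i)).1 = 0 ∧ ∀ r, ∑ i with f i = r, (step (ε i)).2 = 0 := by
    rintro ε ⟨hend, hblock⟩
    have hzero : ∀ k, k ≤ j + 1 →
        (pos ε (∑ q : Fin (j + 1), if (q : ℕ) < k then s q else 0)).2 = 0 := by
      intro k hk
      rcases Nat.eq_zero_or_pos k with rfl | hk0
      · simp [pos]
      · rcases hk.eq_or_lt with rfl | hlt
        · simp only [Fin.is_lt, if_true, hs, hend, Prod.snd_zero]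
        · have h := hblock ⟨k - 1, by omega⟩
          have hiff : ∀ q : ℕ, q ≤ k - 1 ↔ q < k := by omega
          simpa only [hiff] using h
    refine ⟨?_, fun r => ?_⟩
    · simpa [pos, Prod.fst_sum] using congrArg Prod.fst hend
    · simp only [hf]
      rw [← pos_sub_pos_snd, hzero _ (by omega), hzero _ (by omega), sub_zero]
      refine Finset.sum_le_sum fun q _ => ?_
      split_ifs <;> omega
  refine le_trans (Nat.cast_le.2 (card_le_card fun ε hε => ?_)) (hmain.trans ?_)
  · rw [mem_filter_univ] at hε ⊢
    exact hsub ε hε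
  have hpow : ∀ r, ((s r : ℝ) + 1) ^ (-(1 : ℝ) / 2) = 1 / √((s r : ℝ) + 1) := by
    intro r
    rw [neg_div, Real.rpow_neg (by positivity), Real.sqrt_eq_rpow, ← one_div]
  simp only [hpow]
  rw [Finset.prod_mul_distrib, Finset.prod_const, card_univ, Fintype.card_fin, ← mul_assoc]
  have hP : 0 ≤ ∏ r, 1 / √((s r : ℝ) + 1) := by positivity
  refine mul_le_mul_of_nonneg_right ?_ hP
  have h16 : (16 : ℝ) ^ N ≤ 4 * N * (((2 * N).choose N : ℝ)) ^ 2 := by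
    exact_mod_cast sixteen_pow_le_mul_centralBinom_sq hN
  have hN0 : (0 : ℝ) ≤ N := Nat.cast_nonneg N
  have hroot : (N : ℝ) / √((N : ℝ) + 1) ≤ √(2 * (N : ℝ) + 1) := by
    rw [div_le_iff₀ (by positivity), ← Real.sqrt_mul (by positivity)]
    refine Real.le_sqrt_of_sq_le ?_
    nlinarith
  have hc : (24 : ℝ) * (3 / 2) ^ (j + 1) ≤ 36 ^ (j + 1) := by
    have h : (24 : ℝ) ≤ 24 ^ (j + 1) := le_self_pow₀ (by norm_num) (by omega)
    calc (24 : ℝ) * (3 / 2) ^ (j + 1) ≤ 24 ^ (j + 1) * (3 / 2) ^ (j + 1) := by gcongr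
      _ = 36 ^ (j + 1) := by rw [← mul_pow]; norm_num
  calc (16 : ℝ) ^ N * 6 / √((N : ℝ) + 1) * (3 / 2) ^ (j + 1)
      ≤ 4 * N * (((2 * N).choose N : ℝ)) ^ 2 * 6 / √((N : ℝ) + 1) * (3 / 2) ^ (j + 1) := by
        gcongr
    _ = (((2 * N).choose N : ℝ)) ^ 2 * (N / √((N : ℝ) + 1)) * (24 * (3 / 2) ^ (j + 1)) := by ring
    _ ≤ _ := by gcongr
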